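/- arXiv:2201.08168 — 2 statements merged into one kernel-verified Lean document; each statement's English description precedes it below -/
import Mathlib

section
/- Let k ≥ 1, m ≥ 0, and 0 ≤ l < k. Then the number mp_{213,132}(km+l, k) of mod-k-alternating permutations of [km+l] avoiding both 213 and 132 equals 2^{m−1} if l = 0 (and m ≥ 1), and equals F_{2m+1} if l ≥ 1, where F_n are the Fibonacci numbers with F_1 = F_2 = 1. -/
open Finset

/-- A permutation `π` of `Fin n` contains the length-3 pattern `σ`
(given as a permutation of `Fin 3`, read as the word `σ 0, σ 1, σ 2`). -/
def Pattern3 {n : ℕ} (σ : Equiv.Perm (Fin 3)) (π : Equiv.Perm (Fin n)) : Prop :=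
  ∃ f : Fin 3 → Fin n, StrictMono f ∧ ∀ a b : Fin 3, σ a < σ b ↔ π (f a) < π (f b)

/-- The pattern 123. -/
def pat123 : Equiv.Perm (Fin 3) := 1
/-- The pattern 132. -/
def pat132 : Equiv.Perm (Fin 3) := Equiv.swap 1 2
/-- The pattern 213. -/
def pat213 : Equiv.Perm (Fin 3) := Equiv.swap 0 1
/-- The pattern 231. -/
def pat231 : Equiv.Perm (Fin 3) := finRotate 3
/-- The pattern 312. -/
def pat312 : Equiv.Perm (Fin 3) := (finRotate 3)⁻¹
/-- The pattern 321. -/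
def pat321 : Equiv.Perm (Fin 3) := Equiv.swap 0 2

/-- Mod-k-alternating: `π(i) ≡ i (mod k)` (1-based; equivalently 0-based). -/
def ModKAlt {n : ℕ} (k : ℕ) (π : Equiv.Perm (Fin n)) : Prop :=
  ∀ i : Fin n, (π i : ℕ) % k = (i : ℕ) % k

/-- `π(i) ≡ r + i − 1 (mod k)` for all `i ∈ [n]` (1-based). -/
def ModKAltR {n : ℕ} (k r : ℕ) (π : Equiv.Perm (Fin n)) : Prop :=
  ∀ i : Fin n, ((π i : ℕ) + 1) % k = (r + (i : ℕ)) % k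

/-- `mp_σ(n,k)`: number of mod-k-alternating permutations of `[n]` avoiding `σ`. -/
noncomputable def mpPat (k : ℕ) (σ : Equiv.Perm (Fin 3)) (n : ℕ) : ℕ :=
  Nat.card {π : Equiv.Perm (Fin n) // ModKAlt k π ∧ ¬ Pattern3 σ π}

/-- `mp_σ(n,k,r)`: number of permutations in `MP(n,k,r)` avoiding `σ`. -/
noncomputable def mpPatR (k r : ℕ) (σ : Equiv.Perm (Fin 3)) (n : ℕ) : ℕ :=
  Nat.card {π : Equiv.Perm (Fin n) // ModKAltR k r π ∧ ¬ Pattern3 σ π}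

/-- `mp_{σ,τ}(n,k)`: number of mod-k-alternating permutations of `[n]` avoiding both `σ` and `τ`. -/
noncomputable def mpPat2 (k : ℕ) (σ τ : Equiv.Perm (Fin 3)) (n : ℕ) : ℕ :=
  Nat.card {π : Equiv.Perm (Fin n) // ModKAlt k π ∧ ¬ Pattern3 σ π ∧ ¬ Pattern3 τ π}

/-- The revflip involution: `revflip(π)(i) = n + 1 − π(n + 1 − i)` (1-based). -/
def revflip {n : ℕ} (π : Equiv.Perm (Fin n)) : Equiv.Perm (Fin n) :=
  (Fin.revPerm.trans π).trans Fin.revPerm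

/-- `f` encodes a permutation of `{0, …, n - 1}` (extended by zero) that avoids 213 and 132 and
satisfies `f i ≡ i + r (mod k)`. -/
structure IsShiftedAvoider (k n r : ℕ) (f : ℕ → ℕ) : Prop where
  zero_of_le : ∀ i, n ≤ i → f i = 0
  lt : ∀ i < n, f i < n
  inj : ∀ i < n, ∀ j < n, f i = f j → i = j
  surj : ∀ v < n, ∃ i < n, f i = v
  mod : ∀ i < n, f i % k = (i + r) % k
  avoid_213 : ∀ a b c, a < b → b < c → c < n → f b < f a → f a < f c → False
  avoid_132 : ∀ a b c, a < b → b < c → c < n → f a < f c → f c < f b → False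

/-- The word `j, j + 1, …, n - 1` followed by the word `g` of length `j`. -/
def prependRun (n j : ℕ) (g : ℕ → ℕ) (i : ℕ) : ℕ :=
  if i < n - j then j + i else g (i - (n - j))

namespace IsShiftedAvoider

variable {k n r j : ℕ} {f g : ℕ → ℕ}

theorem apply_of_lt (hf : IsShiftedAvoider k n r f) :
    ∀ i < n - f 0, f i = f 0 + i := by
  intro i
  induction i using Nat.strong_induction_on with
  | _ i ih =>
    intro hi
    rcases Nat.eq_zero_or_pos i with rfl | hpos
    · simp
    obtain ⟨p, hp, hpv⟩ := hf.surj (f 0 + i) (by omega)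
    have hip : i ≤ p := by
      by_contra! h
      have := ih p h (by omega)
      omega
    rcases hip.eq_or_lt with rfl | hip
    · exact hpv
    exfalso
    have hne : f i ≠ f p := fun h => by
      have := hf.inj i (by omega) p hp h
      omega
    rcases lt_or_ge (f i) (f 0) with h | h
    · exact hf.avoid_213 0 i p hpos hip hp h (by omega)
    · have hgt : f 0 + i < f i := by
        by_contra! hle
        have h1 := ih (f i - f 0) (by omega) (by omega)
        have h2 := hf.inj (f i - f 0) (by omega) i (by omega) (by omega)
        omega
      exact hf.avoid_132 0 i p hpos hip hp (by omega) (by omega)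

theorem apply_lt_of_le (hf : IsShiftedAvoider k n r f) {i : ℕ} (hi : n - f 0 ≤ i) (hin : i < n) :
    f i < f 0 := by
  by_contra! h
  have h0 := hf.lt i hin
  have h1 := hf.apply_of_lt (f i - f 0) (by omega)
  have h2 := hf.inj (f i - f 0) (by omega) i hin (by omega)
  omega

theorem tail (hf : IsShiftedAvoider k n r f) (hn : 0 < n) :
    IsShiftedAvoider k (f 0) n (fun i => f (i + (n - f 0))) := by
  have h0 := hf.lt 0 hn
  constructor
  · intro i hi
    exact hf.zero_of_le _ (by omega)
  · intro i hi
    exact hf.apply_lt_of_le (by omega) (by omega)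
  · intro a ha b hb h
    have := hf.inj _ (by omega) _ (by omega) h
    omega
  · intro v hv
    obtain ⟨i, hi, rfl⟩ := hf.surj v (by omega)
    have : n - f 0 ≤ i := by
      by_contra! h
      have := hf.apply_of_lt i h
      omega
    exact ⟨i - (n - f 0), by omega, by simp [Nat.sub_add_cancel this]⟩
  · intro i hi
    have h1 : f 0 ≡ 0 + r [MOD k] := hf.mod 0 hn
    have h2 : f (i + (n - f 0)) ≡ i + (n - f 0) + r [MOD k] := hf.mod _ (by omega)
    have h3 : i + (n - f 0) + f 0 ≡ i + (n - f 0) + (0 + r) [MOD k] := h1.add_left _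
    have h4 : i + (n - f 0) + f 0 = i + n := by omega
    rw [h4, zero_add] at h3
    exact h2.trans h3.symm
  · intro a b c hab hbc hc
    exact hf.avoid_213 _ _ _ (by omega) (by omega) (by omega)
  · intro a b c hab hbc hc
    exact hf.avoid_132 _ _ _ (by omega) (by omega) (by omega)

theorem prependRun_tail (hf : IsShiftedAvoider k n r f) :
    prependRun n (f 0) (fun i => f (i + (n - f 0))) = f := by
  funext i
  unfold prependRun
  split_ifs with h
  · exact (hf.apply_of_lt i h).symm
  · simp [Nat.sub_add_cancel (not_lt.mp h)]

theorem prependRun (hg : IsShiftedAvoider k j n g) (hj : j < n) (hr : j % k = r % k) :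
    IsShiftedAvoider k n r (prependRun n j g) := by
  have lo : ∀ i, i < n - j → _root_.prependRun n j g i = j + i := fun i h => if_pos h
  have hi : ∀ i, n - j ≤ i → _root_.prependRun n j g i = g (i - (n - j)) :=
    fun i h => if_neg (not_lt.mpr h)
  have hi_lt : ∀ i, n - j ≤ i → i < n → g (i - (n - j)) < j :=
    fun i h h' => hg.lt _ (by omega)
  constructor
  · intro i h
    rw [hi i (by omega)]
    exact hg.zero_of_le _ (by omega)
  · intro i h
    rcases lt_or_ge i (n - j) with h1 | h1
    · rw [lo i h1]; omega
    · rw [hi i h1]; have := hi_lt i h1 h; omega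
  · intro a ha b hb h
    rcases lt_or_ge a (n - j) with h1 | h1 <;> rcases lt_or_ge b (n - j) with h2 | h2
    · rw [lo a h1, lo b h2] at h; omega
    · rw [lo a h1, hi b h2] at h; have := hi_lt b h2 hb; omega
    · rw [hi a h1, lo b h2] at h; have := hi_lt a h1 ha; omega
    · rw [hi a h1, hi b h2] at h
      have := hg.inj _ (by omega) _ (by omega) h
      omega
  · intro v hv
    rcases lt_or_ge v j with h | h
    · obtain ⟨i, hij, rfl⟩ := hg.surj v h
      exact ⟨i + (n - j), by omega, by rw [hi _ (by omega)]; simp⟩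
    · exact ⟨v - j, by omega, by rw [lo _ (by omega)]; omega⟩
  · intro i h
    rcases lt_or_ge i (n - j) with h1 | h1
    · rw [lo i h1, add_comm]
      exact Nat.ModEq.add_left i hr
    · rw [hi i h1]
      have h2 : g (i - (n - j)) ≡ i - (n - j) + n [MOD k] := hg.mod _ (by omega)
      have h3 : i - (n - j) + n = i + j := by omega
      rw [h3] at h2
      exact h2.trans (Nat.ModEq.add_left i hr)
  · intro a b c hab hbc hc h1 h2
    rcases lt_or_ge b (n - j) with hb | hb
    · rw [lo a (by omega), lo b hb] at h1; omega
    rw [hi c (by omega)] at h2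
    have hcj := hi_lt c (by omega) hc
    rcases lt_or_ge a (n - j) with ha | ha
    · rw [lo a ha] at h2; omega
    rw [hi a ha] at h1 h2
    rw [hi b hb] at h1
    exact hg.avoid_213 _ _ _ (by omega) (by omega) (by omega) h1 h2
  · intro a b c hab hbc hc h1 h2
    rcases lt_or_ge c (n - j) with hcj | hcj
    · rw [lo b (by omega), lo c hcj] at h2; omega
    rw [hi c hcj] at h1 h2
    have := hi_lt c hcj hc
    rcases lt_or_ge a (n - j) with ha | ha
    · rw [lo a ha] at h1; omega
    rw [hi a ha] at h1
    rw [hi b (by omega)] at h2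
    exact hg.avoid_132 _ _ _ (by omega) (by omega) (by omega) h1 h2

theorem prependRun_bijective (k r : ℕ) (hn : 0 < n) :
    Function.Bijective (fun p : Σ j : {j // j ∈ (range n).filter fun j => j % k = r % k},
        {g // IsShiftedAvoider k j n g} =>
      (⟨_root_.prependRun n p.1 p.2.1, p.2.2.prependRun
        (mem_range.mp (mem_filter.mp p.1.2).1) (mem_filter.mp p.1.2).2⟩ :
        {f // IsShiftedAvoider k n r f})) := by
  constructor
  · rintro ⟨⟨j, hj⟩, g, hg⟩ ⟨⟨j', hj'⟩, g', hg'⟩ h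
    have h : _root_.prependRun n j g = _root_.prependRun n j' g' := congrArg Subtype.val h
    simp only [mem_filter, mem_range] at hj hj'
    have h0 := congrFun h 0
    simp only [_root_.prependRun, if_pos (Nat.sub_pos_of_lt hj.1),
      if_pos (Nat.sub_pos_of_lt hj'.1), add_zero] at h0
    subst h0
    have hgg : g = g' := by
      funext i
      simpa [_root_.prependRun] using congrFun h (i + (n - j))
    subst hgg
    rfl
  · rintro ⟨f, hf⟩
    refine ⟨⟨⟨f 0, ?_⟩, _, hf.tail hn⟩, Subtype.ext hf.prependRun_tail⟩
    simpa [hf.lt 0 hn] using hf.mod 0 hn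

end IsShiftedAvoider

/-- The number of 213- and 132-avoiding permutations of size `n` with `π(i) ≡ i + r (mod k)`. -/
noncomputable def shiftedAvoiderCount (k n r : ℕ) : ℕ :=
  Nat.card {f // IsShiftedAvoider k n r f}

theorem eq_zero_of_isShiftedAvoider_zero {k r : ℕ} {f : ℕ → ℕ} (hf : IsShiftedAvoider k 0 r f) :
    f = 0 :=
  funext fun i => hf.zero_of_le i i.zero_le

instance subsingleton_isShiftedAvoider_zero (k r : ℕ) :
    Subsingleton {f // IsShiftedAvoider k 0 r f} :=
  ⟨fun f g => Subtype.ext ((eq_zero_of_isShiftedAvoider_zero f.2).trans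
    (eq_zero_of_isShiftedAvoider_zero g.2).symm)⟩

instance finite_isShiftedAvoider (k n r : ℕ) : Finite {f // IsShiftedAvoider k n r f} := by
  induction n using Nat.strong_induction_on generalizing r with
  | _ n ih =>
    rcases Nat.eq_zero_or_pos n with rfl | hn
    · infer_instance
    · have : ∀ j : {j // j ∈ (range n).filter fun j => j % k = r % k},
          Finite {g // IsShiftedAvoider k j n g} :=
        fun j => ih j (mem_range.mp (mem_filter.mp j.2).1) n
      exact Finite.of_surjective _ (IsShiftedAvoider.prependRun_bijective k r hn).surjective

theorem shiftedAvoiderCount_zero (k r : ℕ) : shiftedAvoiderCount k 0 r = 1 := by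
  have : Nonempty {f // IsShiftedAvoider k 0 r f} :=
    ⟨0, by constructor <;> simp⟩
  exact Nat.card_of_subsingleton this.some

theorem shiftedAvoiderCount_eq_sum (k r : ℕ) {n : ℕ} (hn : 0 < n) :
    shiftedAvoiderCount k n r =
      ∑ j ∈ range n, if j % k = r % k then shiftedAvoiderCount k j n else 0 := by
  rw [shiftedAvoiderCount, ← Nat.card_eq_of_bijective _
    (IsShiftedAvoider.prependRun_bijective k r hn), Nat.card_sigma, ← sum_filter]
  exact sum_coe_sort _ fun j => shiftedAvoiderCount k j n

theorem shiftedAvoiderCount_congr {k n r s : ℕ} (h : r % k = s % k) :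
    shiftedAvoiderCount k n r = shiftedAvoiderCount k n s := by
  rcases Nat.eq_zero_or_pos n with rfl | hn
  · simp only [shiftedAvoiderCount_zero]
  · simp only [shiftedAvoiderCount_eq_sum k _ hn, h]

theorem sum_range_ite_mod_eq {k r l : ℕ} (hr : r < k) (hl : l ≤ k) (m : ℕ) (g : ℕ → ℕ) :
    ∑ j ∈ range (k * m + l), (if j % k = r then g j else 0) =
      ∑ i ∈ range m, g (k * i + r) + if r < l then g (k * m + r) else 0 := by
  induction m generalizing l with
  | zero =>
    have h : ∀ j ∈ range l, (if j % k = r then g j else 0) = if r = j then g j else 0 := by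
      intro j hj
      rw [Nat.mod_eq_of_lt (lt_of_lt_of_le (mem_range.mp hj) hl)]
      simp only [eq_comm]
    simp [sum_congr rfl h]
  | succ m ih =>
    have h : ∀ j ∈ range l, (if (k * (m + 1) + j) % k = r then g (k * (m + 1) + j) else 0) =
        if r = j then g (k * (m + 1) + j) else 0 := by
      intro j hj
      rw [Nat.mul_add_mod, Nat.mod_eq_of_lt (lt_of_lt_of_le (mem_range.mp hj) hl)]
      simp only [eq_comm]
    rw [sum_range_add, sum_congr rfl h, mul_add_one, ih le_rfl, sum_range_succ]
    simp [hr]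

theorem shiftedAvoiderCount_mul {k : ℕ} (hk : 0 < k) (m : ℕ) :
    shiftedAvoiderCount k (k * (m + 1)) 0 = 2 ^ m := by
  have hrec : ∀ m, shiftedAvoiderCount k (k * (m + 1)) 0 =
      ∑ i ∈ range (m + 1), shiftedAvoiderCount k (k * i) 0 := by
    intro m
    have h := sum_range_ite_mod_eq hk (Nat.zero_le k) (m + 1)
      fun j => shiftedAvoiderCount k j (k * (m + 1))
    rw [shiftedAvoiderCount_eq_sum k 0 (by positivity), Nat.zero_mod]
    simp only [add_zero, not_lt_zero, if_false] at h
    rw [h]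
    exact sum_congr rfl fun i _ => shiftedAvoiderCount_congr (by simp)
  induction m with
  | zero => rw [hrec, sum_range_one, mul_zero, shiftedAvoiderCount_zero, pow_zero]
  | succ m ih => rw [hrec, sum_range_succ, ← hrec, ih, pow_succ, mul_two]

theorem shiftedAvoiderCount_mul_add {k l : ℕ} (hl : 0 < l) (hlk : l < k) (m : ℕ) :
    shiftedAvoiderCount k (k * m + l) 0 = Nat.fib (2 * m + 1) := by
  have hk : 0 < k := hl.trans hlk
  have rec₀ : ∀ m, shiftedAvoiderCount k (k * m + l) 0 =
      ∑ i ∈ range (m + 1), shiftedAvoiderCount k (k * i) l := by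
    intro m
    have h := sum_range_ite_mod_eq hk hlk.le m fun j => shiftedAvoiderCount k j (k * m + l)
    rw [shiftedAvoiderCount_eq_sum k 0 (by positivity), Nat.zero_mod, h, if_pos hl,
      ← sum_range_succ (fun i => shiftedAvoiderCount k (k * i + 0) (k * m + l))]
    exact sum_congr rfl fun i _ => shiftedAvoiderCount_congr (by simp)
  have recₗ : ∀ m, shiftedAvoiderCount k (k * (m + 1)) l =
      ∑ i ∈ range (m + 1), shiftedAvoiderCount k (k * i + l) 0 := by
    intro m
    have h := sum_range_ite_mod_eq hlk (Nat.zero_le k) (m + 1)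
      fun j => shiftedAvoiderCount k j (k * (m + 1))
    rw [shiftedAvoiderCount_eq_sum k l (by positivity), Nat.mod_eq_of_lt hlk]
    simp only [add_zero, not_lt_zero, if_false] at h
    rw [h]
    exact sum_congr rfl fun i _ => shiftedAvoiderCount_congr (by simp)
  suffices h : shiftedAvoiderCount k (k * m + l) 0 = Nat.fib (2 * m + 1) ∧
      shiftedAvoiderCount k (k * (m + 1)) l = Nat.fib (2 * m + 2) from h.1
  induction m with
  | zero =>
    have h₀ : shiftedAvoiderCount k (k * 0 + l) 0 = 1 := by
      rw [rec₀, sum_range_one, mul_zero, shiftedAvoiderCount_zero]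
    exact ⟨h₀, by rw [recₗ, sum_range_one, h₀]; rfl⟩
  | succ m ih =>
    have h₀ : shiftedAvoiderCount k (k * (m + 1) + l) 0 = Nat.fib (2 * (m + 1) + 1) := by
      rw [rec₀, sum_range_succ, ← rec₀, ih.1, ih.2]
      exact Nat.fib_add_two.symm
    refine ⟨h₀, ?_⟩
    rw [recₗ, sum_range_succ, ← recₗ, ih.2, h₀]
    exact Nat.fib_add_two.symm

theorem pattern3_pat213_iff {n : ℕ} (π : Equiv.Perm (Fin n)) :
    Pattern3 pat213 π ↔ ∃ a b c, a < b ∧ b < c ∧ π b < π a ∧ π a < π c := by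
  constructor
  · rintro ⟨f, hf, h⟩
    exact ⟨f 0, f 1, f 2, hf (by decide), hf (by decide), (h 1 0).mp (by decide),
      (h 0 2).mp (by decide)⟩
  · rintro ⟨a, b, c, hab, hbc, h1, h2⟩
    refine ⟨![a, b, c], ?_, ?_⟩
    · rw [Fin.strictMono_iff_lt_succ]
      intro i
      fin_cases i <;> simpa
    · intro i j
      fin_cases i <;> fin_cases j <;> simp [pat213, Equiv.swap_apply_def] <;> order

theorem pattern3_pat132_iff {n : ℕ} (π : Equiv.Perm (Fin n)) :
    Pattern3 pat132 π ↔ ∃ a b c, a < b ∧ b < c ∧ π a < π c ∧ π c < π b := by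
  constructor
  · rintro ⟨f, hf, h⟩
    exact ⟨f 0, f 1, f 2, hf (by decide), hf (by decide), (h 0 2).mp (by decide),
      (h 2 1).mp (by decide)⟩
  · rintro ⟨a, b, c, hab, hbc, h1, h2⟩
    refine ⟨![a, b, c], ?_, ?_⟩
    · rw [Fin.strictMono_iff_lt_succ]
      intro i
      fin_cases i <;> simpa
    · intro i j
      fin_cases i <;> fin_cases j <;> simp [pat132, Equiv.swap_apply_def] <;> order

/-- The word of a permutation of `Fin n`, extended by zero. -/
def permWord {n : ℕ} (π : Equiv.Perm (Fin n)) (i : ℕ) : ℕ :=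
  if h : i < n then π ⟨i, h⟩ else 0

theorem permWord_of_lt {n : ℕ} (π : Equiv.Perm (Fin n)) {i : ℕ} (h : i < n) :
    permWord π i = π ⟨i, h⟩ :=
  dif_pos h

theorem isShiftedAvoider_permWord_iff {k n : ℕ} (π : Equiv.Perm (Fin n)) :
    IsShiftedAvoider k n 0 (permWord π) ↔
      ModKAlt k π ∧ ¬ Pattern3 pat213 π ∧ ¬ Pattern3 pat132 π := by
  have hw : ∀ i : Fin n, permWord π i = π i := fun i => permWord_of_lt π i.2
  rw [pattern3_pat213_iff, pattern3_pat132_iff]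
  constructor
  · intro h
    refine ⟨fun i => ?_, ?_, ?_⟩
    · simpa [hw] using h.mod i i.2
    · rintro ⟨a, b, c, hab, hbc, h1, h2⟩
      exact h.avoid_213 a b c hab hbc c.2 (by simpa [hw]) (by simpa [hw])
    · rintro ⟨a, b, c, hab, hbc, h1, h2⟩
      exact h.avoid_132 a b c hab hbc c.2 (by simpa [hw]) (by simpa [hw])
  · rintro ⟨hm, h213, h132⟩
    constructor
    · intro i hi
      exact dif_neg (not_lt.mpr hi)
    · intro i hi
      rw [permWord_of_lt π hi]
      exact (π _).2
    · intro i hi j hj h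
      rw [permWord_of_lt π hi, permWord_of_lt π hj] at h
      simpa using π.injective (Fin.ext h)
    · intro v hv
      exact ⟨π.symm ⟨v, hv⟩, (π.symm _).2, by simp [hw]⟩
    · intro i hi
      rw [permWord_of_lt π hi]
      exact hm ⟨i, hi⟩
    · intro a b c hab hbc hc h1 h2
      rw [permWord_of_lt π (hab.trans (hbc.trans hc))] at h1 h2
      rw [permWord_of_lt π (hbc.trans hc)] at h1
      rw [permWord_of_lt π hc] at h2
      exact h213 ⟨_, _, _, hab, hbc, h1, h2⟩
    · intro a b c hab hbc hc h1 h2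
      rw [permWord_of_lt π hc] at h1 h2
      rw [permWord_of_lt π (hab.trans (hbc.trans hc))] at h1
      rw [permWord_of_lt π (hbc.trans hc)] at h2
      exact h132 ⟨_, _, _, hab, hbc, h1, h2⟩

theorem permWord_injective (n : ℕ) :
    Function.Injective (permWord : Equiv.Perm (Fin n) → ℕ → ℕ) := by
  intro π τ h
  ext i
  simpa [permWord] using congrFun h i

theorem IsShiftedAvoider.exists_permWord_eq {k n r : ℕ} {f : ℕ → ℕ}
    (hf : IsShiftedAvoider k n r f) : ∃ π : Equiv.Perm (Fin n), permWord π = f := by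
  have hinj : Function.Injective fun i : Fin n => (⟨f i, hf.lt i i.2⟩ : Fin n) :=
    fun i j h => Fin.ext (hf.inj i i.2 j j.2 (congrArg Fin.val h))
  refine ⟨Equiv.ofBijective _ (Finite.injective_iff_bijective.mp hinj), funext fun i => ?_⟩
  unfold permWord
  split_ifs with h
  · rfl
  · exact (hf.zero_of_le i (not_lt.mp h)).symm

theorem mpPat2_pat213_pat132 (k n : ℕ) :
    mpPat2 k pat213 pat132 n = shiftedAvoiderCount k n 0 := by
  refine Nat.card_eq_of_bijective
    (fun π => ⟨permWord π.1, (isShiftedAvoider_permWord_iff π.1).mpr π.2⟩) ⟨?_, ?_⟩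
  · intro π τ h
    exact Subtype.ext (permWord_injective n (congrArg Subtype.val h))
  · rintro ⟨f, hf⟩
    obtain ⟨π, rfl⟩ := hf.exists_permWord_eq
    exact ⟨⟨π, (isShiftedAvoider_permWord_iff π).mp hf⟩, rfl⟩

theorem mp_213_132_count (k m l : ℕ) (hk : 1 ≤ k) (hl : l < k) :
    (l = 0 → 1 ≤ m → mpPat2 k pat213 pat132 (k * m) = 2 ^ (m - 1)) ∧
    (1 ≤ l → mpPat2 k pat213 pat132 (k * m + l) = Nat.fib (2 * m + 1)) := by
  refine ⟨?_, fun h => ?_⟩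
  · intro _ hm
    obtain ⟨m, rfl⟩ := Nat.exists_eq_add_of_le' hm
    rw [mpPat2_pat213_pat132, shiftedAvoiderCount_mul hk, Nat.add_sub_cancel]
  · rw [mpPat2_pat213_pat132, shiftedAvoiderCount_mul_add h hl]
end

section
/- For every n ≥ 1, the number of parity-alternating permutations of [n] avoiding both 312 and 231 equals the n-th Fibonacci number: p_{312,231}(n) = F_n, where F_1 = F_2 = 1. -/
open Finset

theorem pattern3_pat231_iff {n : ℕ} (π : Equiv.Perm (Fin n)) :
    Pattern3 pat231 π ↔ ∃ a b c, a < b ∧ b < c ∧ π c < π a ∧ π a < π b := by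
  constructor
  · rintro ⟨f, hf, h⟩
    exact ⟨f 0, f 1, f 2, hf (by decide), hf (by decide), (h 2 0).1 (by decide),
      (h 0 1).1 (by decide)⟩
  · rintro ⟨a, b, c, hab, hbc, h₁, h₂⟩
    refine ⟨![a, b, c], ?_, ?_⟩
    · intro i j hij
      fin_cases i <;> fin_cases j <;> simp_all
      omega
    · intro i j
      fin_cases i <;> fin_cases j <;> simp [pat231] <;> omega

theorem pattern3_pat312_iff {n : ℕ} (π : Equiv.Perm (Fin n)) :
    Pattern3 pat312 π ↔ ∃ a b c, a < b ∧ b < c ∧ π b < π c ∧ π c < π a := by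
  constructor
  · rintro ⟨f, hf, h⟩
    exact ⟨f 0, f 1, f 2, hf (by decide), hf (by decide), (h 1 2).1 (by decide),
      (h 2 0).1 (by decide)⟩
  · rintro ⟨a, b, c, hab, hbc, h₁, h₂⟩
    have e₀ : pat312 0 = 2 := by decide
    have e₁ : pat312 1 = 0 := by decide
    have e₂ : pat312 2 = 1 := by decide
    refine ⟨![a, b, c], ?_, ?_⟩
    · intro i j hij
      fin_cases i <;> fin_cases j <;> simp_all
      omega
    · intro i j
      fin_cases i <;> fin_cases j <;> simp [e₀, e₁, e₂] <;> omega

open Classical in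
/-- The parity-alternating permutations of `Fin n` avoiding 312 and 231. -/
noncomputable def layeredPAP (n : ℕ) : Finset (Equiv.Perm (Fin n)) :=
  univ.filter fun π => ModKAlt 2 π ∧ ¬ Pattern3 pat312 π ∧ ¬ Pattern3 pat231 π

theorem mpPat2_eq_card_layeredPAP (n : ℕ) : mpPat2 2 pat312 pat231 n = #(layeredPAP n) := by
  classical
  rw [mpPat2, Nat.card_eq_fintype_card, Fintype.card_subtype, layeredPAP]

/-- Prepend a decreasing layer of size `k + 1` to a permutation. -/
def prependLayer (k : ℕ) {m : ℕ} (π : Equiv.Perm (Fin m)) : Equiv.Perm (Fin (k + 1 + m)) :=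
  finSumFinEquiv.permCongr (Equiv.sumCongr Fin.revPerm π)

@[simp] theorem prependLayer_castAdd (k : ℕ) {m : ℕ} (π : Equiv.Perm (Fin m)) (i : Fin (k + 1)) :
    prependLayer k π (Fin.castAdd m i) = Fin.castAdd m i.rev := by
  simp [prependLayer, Equiv.permCongr_apply]

@[simp] theorem prependLayer_natAdd (k : ℕ) {m : ℕ} (π : Equiv.Perm (Fin m)) (i : Fin m) :
    prependLayer k π (Fin.natAdd (k + 1) i) = Fin.natAdd (k + 1) (π i) := by
  simp [prependLayer, Equiv.permCongr_apply]

theorem prependLayer_injective (k m : ℕ) :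
    Function.Injective (prependLayer k : Equiv.Perm (Fin m) → _) := by
  intro π π' h
  ext i
  have := congrArg (fun σ => (σ (Fin.natAdd (k + 1) i) : ℕ)) h
  simpa using this

theorem modKAlt_prependLayer_iff {k m : ℕ} (hk : k % 2 = 0) (π : Equiv.Perm (Fin m)) :
    ModKAlt 2 (prependLayer k π) ↔ ModKAlt 2 π := by
  constructor
  · intro h i
    have := h (Fin.natAdd (k + 1) i)
    simp at this
    omega
  · intro h i
    induction i using Fin.addCases with
    | left i => simp [Fin.val_rev]; omega
    | right i => have := h i; simp; omega

theorem pattern3_pat231_prependLayer_iff {k m : ℕ} (π : Equiv.Perm (Fin m)) :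
    Pattern3 pat231 (prependLayer k π) ↔ Pattern3 pat231 π := by
  rw [pattern3_pat231_iff, pattern3_pat231_iff]
  constructor
  · rintro ⟨a, b, c, h⟩
    induction a using Fin.addCases <;> induction b using Fin.addCases <;>
      induction c using Fin.addCases <;>
      simp [Fin.lt_def, Fin.val_rev, -Fin.val_fin_lt] at h <;> first | omega | skip
    exact ⟨_, _, _, h⟩
  · rintro ⟨a, b, c, h⟩
    exact ⟨Fin.natAdd _ a, Fin.natAdd _ b, Fin.natAdd _ c, by simpa using h⟩

theorem pattern3_pat312_prependLayer_iff {k m : ℕ} (π : Equiv.Perm (Fin m)) :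
    Pattern3 pat312 (prependLayer k π) ↔ Pattern3 pat312 π := by
  rw [pattern3_pat312_iff, pattern3_pat312_iff]
  constructor
  · rintro ⟨a, b, c, h⟩
    induction a using Fin.addCases <;> induction b using Fin.addCases <;>
      induction c using Fin.addCases <;>
      simp [Fin.lt_def, Fin.val_rev, -Fin.val_fin_lt] at h <;> first | omega | skip
    exact ⟨_, _, _, h⟩
  · rintro ⟨a, b, c, h⟩
    exact ⟨Fin.natAdd _ a, Fin.natAdd _ b, Fin.natAdd _ c, by simpa using h⟩

theorem prependLayer_mem_layeredPAP_iff {k m : ℕ} (hk : k % 2 = 0) (π : Equiv.Perm (Fin m)) :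
    prependLayer k π ∈ layeredPAP (k + 1 + m) ↔ π ∈ layeredPAP m := by
  simp [layeredPAP, modKAlt_prependLayer_iff hk, pattern3_pat231_prependLayer_iff,
    pattern3_pat312_prependLayer_iff]

/-- If a 231-avoiding permutation starts with the value `k`, its first `k + 1` values
are at most `k`. -/
theorem apply_le_of_not_pattern3_pat231 {n : ℕ} {π : Equiv.Perm (Fin n)}
    (h : ¬ Pattern3 pat231 π) {z i : Fin n} (hz : (z : ℕ) = 0) (hi : i ≤ π z) : π i ≤ π z := by
  rw [pattern3_pat231_iff] at h
  by_contra! hlt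
  have hsub : (Iic (π z)).map π.symm.toEmbedding ⊆ Iio i := by
    intro j hj
    obtain ⟨v, hv, rfl⟩ := mem_map.1 hj
    rw [mem_Iic] at hv
    rw [mem_Iio]
    by_contra! hle
    simp only [Equiv.coe_toEmbedding] at hle
    have hzi : z < i := by
      rcases eq_or_ne z i with rfl | hne
      · exact absurd hlt (lt_irrefl _)
      · have : (z : ℕ) ≠ i := fun e => hne (Fin.ext e)
        rw [Fin.lt_def]; omega
    have hiv : i < π.symm v := by
      refine lt_of_le_of_ne hle ?_
      rintro rfl
      simp at hlt
      omega
    refine h ⟨z, i, π.symm v, hzi, hiv, ?_, hlt⟩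
    rw [Equiv.apply_symm_apply]
    refine lt_of_le_of_ne hv ?_
    rintro rfl
    simp at hiv
    omega
  have := card_le_card hsub
  simp at this
  omega

theorem exists_prependLayer_eq {k m : ℕ} {π : Equiv.Perm (Fin (k + 1 + m))}
    (h₁ : ¬ Pattern3 pat312 π) (h₂ : ¬ Pattern3 pat231 π) {z : Fin (k + 1 + m)}
    (hz : (z : ℕ) = 0) (hk : (π z : ℕ) = k) : ∃ π' : Equiv.Perm (Fin m), prependLayer k π' = π := by
  set σ : Equiv.Perm (Fin (k + 1) ⊕ Fin m) := finSumFinEquiv.symm.permCongr π with hσ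
  have hmaps : Set.MapsTo σ (Set.range Sum.inl) (Set.range Sum.inl) := by
    rintro _ ⟨i, rfl⟩
    have hle : π (Fin.castAdd m i) ≤ π z :=
      apply_le_of_not_pattern3_pat231 h₂ hz (by rw [Fin.le_def, hk]; simp; omega)
    rw [Fin.le_def, hk] at hle
    refine ⟨⟨π (Fin.castAdd m i), by omega⟩, ?_⟩
    apply finSumFinEquiv.injective
    ext
    simp [hσ, Equiv.permCongr_apply]
  obtain ⟨⟨e, π'⟩, he⟩ := Equiv.Perm.mem_sumCongrHom_range_of_perm_mapsTo_inl hmaps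
  have hπ : π = finSumFinEquiv.permCongr (Equiv.sumCongr e π') := by
    have : Equiv.sumCongr e π' = σ := he
    rw [this, hσ]
    ext; simp [Equiv.permCongr_apply]
  have hcast (i : Fin (k + 1)) : π (Fin.castAdd m i) = Fin.castAdd m (e i) := by
    rw [hπ]; simp [Equiv.permCongr_apply]
  have hz' : z = Fin.castAdd m 0 := Fin.ext (by simp [hz])
  have he0 : (e 0 : ℕ) = k := by
    rw [hz', hcast] at hk; simpa using hk
  have hanti : StrictAnti e := by
    intro i j hij
    by_contra! hle
    have hlt : e i < e j := lt_of_le_of_ne hle (fun e' => hij.ne (e.injective e'))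
    have hi : 0 < i := by
      rw [Fin.pos_iff_ne_zero]; rintro rfl
      rw [Fin.lt_def] at hlt; omega
    have hj : e j < e 0 := by
      refine lt_of_le_of_ne (by rw [Fin.le_def]; omega) fun e' => ?_
      exact absurd (e.injective e' ▸ hij) (Fin.not_lt_zero i)
    refine h₁ ((pattern3_pat312_iff π).2
      ⟨Fin.castAdd m 0, Fin.castAdd m i, Fin.castAdd m j, ?_, ?_, ?_, ?_⟩)
    · rw [Fin.lt_def] at hi ⊢
      simpa only [Fin.val_castAdd] using hi
    · simpa [Fin.lt_def, -Fin.val_fin_lt] using hij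
    · simpa [hcast, Fin.lt_def, -Fin.val_fin_lt] using hlt
    · simpa [hcast, Fin.lt_def, -Fin.val_fin_lt] using hj
  have hrev : e = Fin.revPerm := by
    have hmono : StrictMono fun i => (e i).rev := fun i j hij => Fin.rev_lt_rev.2 (hanti hij)
    have hid : (fun i => (e i).rev) = id := hmono.eq_id
    ext i
    have := congrFun hid i
    simp only [id] at this
    rw [Fin.revPerm_apply, ← Fin.rev_eq_iff.1 this]
  exact ⟨π', by rw [hπ, hrev, prependLayer]⟩

theorem card_layeredPAP_fiber {n k m : ℕ} (hn : n = k + 1 + m) (hk : k % 2 = 0) {z : Fin n}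
    (hz : (z : ℕ) = 0) : #{π ∈ layeredPAP n | (π z : ℕ) = k} = #(layeredPAP m) := by
  classical
  subst hn
  rw [← card_image_of_injective _ (prependLayer_injective k m)]
  congr 1
  ext π
  simp only [mem_filter, mem_image]
  constructor
  · rintro ⟨hπ, h0⟩
    have hπ' := hπ
    simp only [layeredPAP, mem_filter, mem_univ, true_and] at hπ'
    obtain ⟨π', rfl⟩ := exists_prependLayer_eq hπ'.2.1 hπ'.2.2 hz h0
    exact ⟨π', (prependLayer_mem_layeredPAP_iff hk π').1 hπ, rfl⟩
  · rintro ⟨π', hπ', rfl⟩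
    refine ⟨(prependLayer_mem_layeredPAP_iff hk π').2 hπ', ?_⟩
    have hz' : z = Fin.castAdd m 0 := Fin.ext (by simp [hz])
    simp [hz']

theorem card_layeredPAP_succ (n : ℕ) : #(layeredPAP (n + 1)) =
    ∑ k ∈ range (n + 1), if k % 2 = 0 then #(layeredPAP (n - k)) else 0 := by
  rw [card_eq_sum_card_fiberwise (f := fun π => (π 0 : ℕ)) (t := range (n + 1))
    (fun π _ => by simpa using (π 0).is_le)]
  refine sum_congr rfl fun k hk => ?_
  rw [mem_range] at hk
  split_ifs with h
  · exact card_layeredPAP_fiber (by omega) h rfl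
  · rw [card_eq_zero, filter_eq_empty_iff]
    intro π hπ h0
    simp only [layeredPAP, mem_filter, mem_univ, true_and] at hπ
    have := hπ.1 0
    rw [h0] at this
    exact h this

theorem card_layeredPAP_zero : #(layeredPAP 0) = 1 := by
  have : layeredPAP 0 = univ := by
    ext π
    simp [layeredPAP, pattern3_pat231_iff, pattern3_pat312_iff, ModKAlt]
  rw [this]; rfl

theorem card_layeredPAP_add_three (n : ℕ) :
    #(layeredPAP (n + 3)) = #(layeredPAP (n + 1)) + #(layeredPAP (n + 2)) := by
  rw [card_layeredPAP_succ (n + 2), sum_range_succ', sum_range_succ', card_layeredPAP_succ n]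
  have h (x : ℕ) : #(layeredPAP (n + 2 - (x + 1 + 1))) = #(layeredPAP (n - x)) := by
    rw [show n + 2 - (x + 1 + 1) = n - x by omega]
  simp [h, add_assoc]

theorem card_layeredPAP_succ_eq_fib (n : ℕ) : #(layeredPAP (n + 1)) = Nat.fib (n + 1) := by
  induction n using Nat.twoStepInduction with
  | zero => simp [card_layeredPAP_succ, card_layeredPAP_zero]
  | one => simp [card_layeredPAP_succ, card_layeredPAP_zero, sum_range_succ]
  | more n ih₁ ih₂ => rw [card_layeredPAP_add_three, ih₁, ih₂, ← Nat.fib_add_two]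

theorem pap_312_231_fibonacci (n : ℕ) (hn : 1 ≤ n) :
    mpPat2 2 pat312 pat231 n = Nat.fib n := by
  obtain ⟨n, rfl⟩ := Nat.exists_eq_add_of_le' hn
  rw [mpPat2_eq_card_layeredPAP, card_layeredPAP_succ_eq_fib]
end
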